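/- arXiv:2504.20924 — 8 statements merged into one kernel-verified Lean document; each statement's English description precedes it below -/
import Mathlib

section
/- Let Ω be a compact metric space and P a Borel probability measure on Ω whose topological support is connected. Let X ⊆ Ω be a finite nonempty set and let δ > 0. Write U = ⋃_{x∈X} B(x, δ/2) and V = ⋃_{x∈X} B(x, 3δ/4), and let V̄ denote the closure of V. Then at least one of the following three statements holds: (S1) P(V̄ \ U) > 0; (S2) P(U) = 0; (S3) P(Ω \ V̄) = 0. -/
open MeasureTheory Metric Set

/-- The topological support of a measure: the set of points all of whose open neighborhoods
have positive measure. -/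
def measSupport {Ω : Type*} [TopologicalSpace Ω] [MeasurableSpace Ω] (P : Measure Ω) : Set Ω :=
  {x | ∀ U : Set Ω, IsOpen U → x ∈ U → 0 < P U}

/-- Any set of positive measure meets the support. -/
lemma measSupport_inter_nonempty {Ω : Type*} [MetricSpace Ω] [CompactSpace Ω]
    [MeasurableSpace Ω] (P : Measure Ω) {s : Set Ω} (hs : P s ≠ 0) :
    (measSupport P ∩ s).Nonempty := by
  obtain ⟨x, hx, hx'⟩ := Measure.nonempty_inter_support_of_pos (pos_iff_ne_zero.2 hs)
  refine ⟨x, ?_, hx⟩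
  intro U hU hxU
  exact (Measure.mem_support_iff_forall x).1 hx' U (hU.mem_nhds hxU)

/-- Let `Ω` be a compact metric space and `P` a Borel probability measure whose topological
support is connected.  For a finite nonempty `X ⊆ Ω` and `δ > 0`, writing
`U = ⋃_{x∈X} B(x, δ/2)` and `V = ⋃_{x∈X} B(x, 3δ/4)`, at least one of the following holds:
`P(closure V \ U) > 0`, `P U = 0`, or `P(Ω \ closure V) = 0`. -/
theorem stmt2 {Ω : Type*} [MetricSpace Ω] [CompactSpace Ω]
    [MeasurableSpace Ω] [BorelSpace Ω]
    (P : Measure Ω) [IsProbabilityMeasure P]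
    (hconn : IsConnected (measSupport P))
    (X : Set Ω) (hXfin : X.Finite) (hXne : X.Nonempty) {δ : ℝ} (hδ : 0 < δ) :
    0 < P (closure (⋃ x ∈ X, ball x (3 * δ / 4)) \ (⋃ x ∈ X, ball x (δ / 2))) ∨
    P (⋃ x ∈ X, ball x (δ / 2)) = 0 ∨
    P (Set.univ \ closure (⋃ x ∈ X, ball x (3 * δ / 4))) = 0 := by
  set U := ⋃ x ∈ X, ball x (δ / 2) with hU
  set V := ⋃ x ∈ X, ball x (3 * δ / 4) with hV
  by_contra! hcon
  obtain ⟨h1, h2, h3⟩ := hcon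
  have hVo : IsOpen V := isOpen_biUnion fun _ _ => isOpen_ball
  have hcl : closure U ⊆ V := by
    rw [hU, hXfin.closure_biUnion]
    exact iUnion₂_mono fun x _ =>
      closure_ball_subset_closedBall.trans (closedBall_subset_ball (by linarith))
  have hUV : U ⊆ V := subset_closure.trans hcl
  obtain ⟨z, hz, hzV, hzU⟩ := hconn.isPreconnected V (closure U)ᶜ hVo
    isClosed_closure.isOpen_compl
    (fun x _ => by
      by_cases hx : x ∈ closure U
      · exact Or.inl (hcl hx)
      · exact Or.inr hx)
    ((measSupport_inter_nonempty P h2).mono (inter_subset_inter_right _ hUV))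
    ((measSupport_inter_nonempty P h3).mono (inter_subset_inter_right _
      (fun x hx hx' => hx.2 (subset_closure (hcl hx')))))
  have hpos := hz (V ∩ (closure U)ᶜ) (hVo.inter isClosed_closure.isOpen_compl) ⟨hzV, hzU⟩
  have hsub : V ∩ (closure U)ᶜ ⊆ closure V \ U := fun x hx =>
    ⟨subset_closure hx.1, fun h => hx.2 (subset_closure h)⟩
  exact absurd (hpos.trans_le (measure_mono hsub)) (not_lt.2 h1)
end

section
/- Let Ω be a compact metric space with Borel probability measure P, let m, N ∈ ℕ with N ≥ 1, let f : Ω → ℝ^m and g : ℝ^m → {1, …, N}, and assume that for each j the set Y_j = {y ∈ Ω : g(f(y)) = j} is Borel. Let ζ, ξ > 0 and assume: (i) for all y_1, y_2 ∈ Ω with dist(y_1, y_2) < ζ one has ‖f(y_1) − f(y_2)‖ ≤ ξ; (ii) (ω_1, …, ω_n) is a ζ-informative sequence in Ω. Then for every class j, the number of indices k ∈ {1, …, n} such that g(φ) = j for every φ ∈ ℝ^m with ‖φ − f(ω_k)‖ ≤ ξ is at most n · P(Y_j). In the paper's notation this says p^{−ξ}(o = j | s) ≤ p*(o = j | s), the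 lower conservative estimate never exceeds the true classification probability. -/
open MeasureTheory Metric Set

/-- A finite sequence `ω : Fin n → Ω` is `ζ`-informative for the measure `P` if for every
subset `X` of indices, the measure of the union of the `ζ`-balls centered at the chosen points
is at least `|X| / n`. -/
def ZetaInformative {Ω : Type*} [MetricSpace Ω] [MeasurableSpace Ω]
    (P : Measure Ω) {n : ℕ} (ω : Fin n → Ω) (ζ : ℝ) : Prop :=
  ∀ X : Finset (Fin n), ((X.card : ℝ) / n) ≤ (P (⋃ i ∈ X, ball (ω i) ζ)).toReal

/-- Lower conservative estimate never exceeds the true classification probability: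
the number of test points `ω k` such that every `φ` within distance `ξ` of `f (ω k)` is
classified as `j` is at most `n * P {y | g (f y) = j}`. -/
theorem stmt4 {Ω : Type*} [MetricSpace Ω] [CompactSpace Ω]
    [MeasurableSpace Ω] [BorelSpace Ω]
    (P : Measure Ω) [IsProbabilityMeasure P]
    {m N : ℕ} (hN : 1 ≤ N)
    (f : Ω → EuclideanSpace ℝ (Fin m)) (g : EuclideanSpace ℝ (Fin m) → Fin N)
    (hY : ∀ j : Fin N, MeasurableSet {y : Ω | g (f y) = j})
    {ζ ξ : ℝ} (hζ : 0 < ζ) (hξ : 0 < ξ)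
    (hunif : ∀ y₁ y₂ : Ω, dist y₁ y₂ < ζ → ‖f y₁ - f y₂‖ ≤ ξ)
    {n : ℕ} (ω : Fin n → Ω) (hinf : ZetaInformative P ω ζ)
    (j : Fin N) :
    ((Set.ncard {k : Fin n |
        ∀ φ : EuclideanSpace ℝ (Fin m), ‖φ - f (ω k)‖ ≤ ξ → g φ = j}) : ℝ)
      ≤ n * (P {y : Ω | g (f y) = j}).toReal := by
  classical
  rw [Set.ncard_eq_toFinset_card']
  set X := Set.toFinset {k : Fin n |
        ∀ φ : EuclideanSpace ℝ (Fin m), ‖φ - f (ω k)‖ ≤ ξ → g φ = j} with hX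
  rcases Nat.eq_zero_or_pos n with h0 | hn
  · have h1 : X.card ≤ n := by simpa using Finset.card_le_univ X
    have h2 : X.card = 0 := by omega
    rw [h2, Nat.cast_zero]
    positivity
  · have hn' : (0 : ℝ) < n := by exact_mod_cast hn
    have h1 := hinf X
    have h2 : (P (⋃ i ∈ X, ball (ω i) ζ)).toReal ≤ (P {y : Ω | g (f y) = j}).toReal := by
      refine ENNReal.toReal_mono (measure_ne_top P _) (measure_mono ?_)
      refine Set.iUnion₂_subset fun i hi y hy => ?_
      have hi' : ∀ φ : EuclideanSpace ℝ (Fin m), ‖φ - f (ω i)‖ ≤ ξ → g φ = j := by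
        simpa [hX] using hi
      exact hi' _ (hunif _ _ (mem_ball.mp hy))
    have h3 := h1.trans h2
    rw [div_le_iff₀ hn'] at h3
    linarith
end

section
/- Let Ω be a compact metric space with Borel probability measure P, let m, N ∈ ℕ with N ≥ 1, let f : Ω → ℝ^m and g : ℝ^m → {1, …, N}, and assume that for each j the set Y_j = {y ∈ Ω : g(f(y)) = j} is Borel. Let ζ, ξ > 0 and assume: (i) for all y_1, y_2 ∈ Ω with dist(y_1, y_2) < ζ one has ‖f(y_1) − f(y_2)‖ ≤ ξ; (ii) (ω_1, …, ω_n) is a ζ-informative sequence in Ω. Then for every class j, n · P(Y_j) is at most the number of indices k ∈ {1, …, n} such that there exists φ ∈ ℝ^m with ‖φ − f(ω_k)‖ ≤ ξ and g(φ) = j. In the paper's notation this says p*(o = j | s) ≤ p^{+ξ}(o = j | s), the true classification probability never exceeds the upper conservative estimate. -/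
open MeasureTheory Metric Set

/-- The true classification probability never exceeds the upper conservative estimate:
`n * P {y | g (f y) = j}` is at most the number of test points `ω k` such that some `φ`
within distance `ξ` of `f (ω k)` is classified as `j`. -/
theorem stmt5 {Ω : Type*} [MetricSpace Ω] [CompactSpace Ω]
    [MeasurableSpace Ω] [BorelSpace Ω]
    (P : Measure Ω) [IsProbabilityMeasure P]
    {m N : ℕ} (hN : 1 ≤ N)
    (f : Ω → EuclideanSpace ℝ (Fin m)) (g : EuclideanSpace ℝ (Fin m) → Fin N)
    (hY : ∀ j : Fin N, MeasurableSet {y : Ω | g (f y) = j})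
    {ζ ξ : ℝ} (hζ : 0 < ζ) (hξ : 0 < ξ)
    (hunif : ∀ y₁ y₂ : Ω, dist y₁ y₂ < ζ → ‖f y₁ - f y₂‖ ≤ ξ)
    {n : ℕ} (ω : Fin n → Ω) (hinf : ZetaInformative P ω ζ)
    (j : Fin N) :
    n * (P {y : Ω | g (f y) = j}).toReal
      ≤ ((Set.ncard {k : Fin n |
          ∃ φ : EuclideanSpace ℝ (Fin m), ‖φ - f (ω k)‖ ≤ ξ ∧ g φ = j}) : ℝ) := by
  classical
  set S : Set (Fin n) := {k : Fin n |
          ∃ φ : EuclideanSpace ℝ (Fin m), ‖φ - f (ω k)‖ ≤ ξ ∧ g φ = j} with hS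
  have hX := hinf (S.toFinsetᶜ)
  rw [Set.ncard_eq_toFinset_card']
  have hc : (S.toFinset.card : ℝ) + (S.toFinsetᶜ.card : ℝ) = n := by
    have := Finset.card_add_card_compl S.toFinset
    rw [Fintype.card_fin] at this
    exact_mod_cast this
  have hsub : (⋃ i ∈ S.toFinsetᶜ, ball (ω i) ζ) ⊆ {y : Ω | g (f y) = j}ᶜ := by
    intro y hy hyj
    simp only [Set.mem_iUnion] at hy
    obtain ⟨i, hi, hyi⟩ := hy
    rw [Finset.mem_compl, Set.mem_toFinset] at hi
    exact hi ⟨f y, hunif _ _ hyi, hyj⟩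
  have h1 : (P (⋃ i ∈ S.toFinsetᶜ, ball (ω i) ζ)).toReal ≤ 1 - (P {y : Ω | g (f y) = j}).toReal := by
    have h2 := measureReal_mono (μ := P) hsub
    rw [probReal_compl_eq_one_sub (hY j)] at h2
    exact h2
  rcases Nat.eq_zero_or_pos n with h0 | h0
  · have : (n : ℝ) = 0 := by exact_mod_cast h0
    rw [this, zero_mul]
    positivity
  · have h0' : (0 : ℝ) < n := by exact_mod_cast h0
    have h3 := hX.trans h1
    rw [div_le_iff₀ h0'] at h3
    linarith
end

section
/- Let n, m, n_c ∈ ℕ and let U = ⋃_{i=1}^{N} X_i × {z_i} ⊆ ℝⁿ × ℤᵐ, where N is finite, each X_i ⊆ ℝⁿ is a nonempty compact set, and z_1, …, z_N ∈ ℤᵐ are pairwise distinct. Let J̄ : ℝⁿ × ℤᵐ → ℝ and c_1, …, c_{n_c} : ℝⁿ × ℤᵐ → ℝ be continuous in the ℝⁿ-variable for each fixed value of the ℤᵐ-variable. Assume the feasible set F = {u ∈ U : c_i(u) ≥ 0 for all i = 1, …, n_c} is nonempty, and let S denote the set of minimizers of J̄ over F; for z ∈ ℤᵐ write S_z = {x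 ∈ ℝⁿ : (x, z) ∈ S}. Then for every ε > 0 there exists β̄ ∈ ℝ^{n_c} with β̄_i > 0 for all i, such that for every β ∈ ℝ^{n_c} with β_i > β̄_i for all i, every minimizer (x̃, z̃) over U of the penalized objective u ↦ J̄(u) − Σ_{i=1}^{n_c} β_i · min(c_i(u), 0) satisfies: there exists x* with (x*, z̃) ∈ S and ‖x* − x̃‖ < ε. -/
open Set

/-- For large enough penalty coefficients, every minimizer of the penalized (converted) problem
lies within distance `ε` of a minimizer of the original constrained problem having the same
discrete component. -/
theorem stmt9 {n m nc N : ℕ}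
    (X : Fin N → Set (EuclideanSpace ℝ (Fin n))) (z : Fin N → (Fin m → ℤ))
    (hXne : ∀ i, (X i).Nonempty) (hXcpt : ∀ i, IsCompact (X i))
    (hz : Function.Injective z)
    (J : EuclideanSpace ℝ (Fin n) × (Fin m → ℤ) → ℝ)
    (c : Fin nc → EuclideanSpace ℝ (Fin n) × (Fin m → ℤ) → ℝ)
    (hJ : ∀ zz : Fin m → ℤ, Continuous fun x => J (x, zz))
    (hc : ∀ (i : Fin nc) (zz : Fin m → ℤ), Continuous fun x => c i (x, zz))
    (U : Set (EuclideanSpace ℝ (Fin n) × (Fin m → ℤ)))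
    (hU : U = ⋃ i, (X i) ×ˢ ({z i} : Set (Fin m → ℤ)))
    (F : Set (EuclideanSpace ℝ (Fin n) × (Fin m → ℤ)))
    (hF : F = {u ∈ U | ∀ i, 0 ≤ c i u})
    (hFne : F.Nonempty)
    (S : Set (EuclideanSpace ℝ (Fin n) × (Fin m → ℤ)))
    (hS : S = {u ∈ F | ∀ v ∈ F, J u ≤ J v})
    {ε : ℝ} (hε : 0 < ε) :
    ∃ βbar : Fin nc → ℝ, (∀ i, 0 < βbar i) ∧
      ∀ β : Fin nc → ℝ, (∀ i, βbar i < β i) →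
        ∀ u ∈ U,
          (∀ v ∈ U, J u - ∑ i, β i * min (c i u) 0 ≤ J v - ∑ i, β i * min (c i v) 0) →
          ∃ xs : EuclideanSpace ℝ (Fin n), (xs, u.2) ∈ S ∧ ‖xs - u.1‖ < ε := by
  have cont : ∀ f : EuclideanSpace ℝ (Fin n) × (Fin m → ℤ) → ℝ,
      (∀ zz, Continuous fun x => f (x, zz)) → Continuous f := by
    intro f hf
    exact continuous_prod_of_discrete_right.mpr hf
  have hJc := cont J hJ
  have hcc : ∀ i, Continuous (c i) := fun i => cont _ (hc i)
  have hUc : IsCompact U := by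
    rw [hU]
    exact isCompact_iUnion fun i => (hXcpt i).prod isCompact_singleton
  have hFc : IsCompact F := by
    have : F = U ∩ ⋂ i, {u | 0 ≤ c i u} := by
      rw [hF]; ext u; simp
    rw [this]
    exact hUc.inter_right (isClosed_iInter fun i => isClosed_le continuous_const (hcc i))
  obtain ⟨s, hsF, hs⟩ := hFc.exists_isMinOn hFne hJc.continuousOn
  have hs' : ∀ v ∈ F, J s ≤ J v := fun v hv => hs hv
  have hsU : s ∈ U := by rw [hF] at hsF; exact hsF.1
  have hsc : ∀ i, 0 ≤ c i s := by rw [hF] at hsF; exact hsF.2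
  obtain ⟨w, hwU, hw⟩ := hUc.exists_isMinOn ⟨s, hsU⟩ hJc.continuousOn
  have hw' : ∀ v ∈ U, J w ≤ J v := fun v hv => hw hv
  let V : EuclideanSpace ℝ (Fin n) × (Fin m → ℤ) → ℝ := fun u => ∑ i, -min (c i u) 0
  have hVc : Continuous V :=
    continuous_finsetSum _ fun i _ => ((hcc i).min continuous_const).neg
  have hterm : ∀ u i, 0 ≤ -min (c i u) 0 := fun u i => by
    have := min_le_right (c i u) 0
    linarith
  let K : Set (EuclideanSpace ℝ (Fin n) × (Fin m → ℤ)) :=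
    (U ∩ {u | J u ≤ J s}) ∩ ⋂ x, ({u | (x, u.2) ∉ S} ∪ {u | ε ≤ ‖x - u.1‖})
  have hK : IsCompact K := by
    refine (hUc.inter_right (isClosed_le hJc continuous_const)).inter_right
      (isClosed_iInter fun x => IsClosed.union ?_ ?_)
    · exact (isClosed_discrete {y : Fin m → ℤ | (x, y) ∉ S}).preimage continuous_snd
    · exact isClosed_le continuous_const (by fun_prop)
  have hKpos : ∀ u ∈ K, 0 < V u := by
    rintro u ⟨⟨huU, huJ⟩, hu⟩
    by_contra hneg
    have hV0 : V u = 0 := le_antisymm (not_lt.mp hneg) (Finset.sum_nonneg fun i _ => hterm u i)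
    have h0 := (Finset.sum_eq_zero_iff_of_nonneg fun i _ => hterm u i).mp hV0
    have huF : u ∈ F := by
      rw [hF]
      refine ⟨huU, fun i => ?_⟩
      have h1 := h0 i (Finset.mem_univ i)
      have h2 := min_le_left (c i u) 0
      linarith
    have huS : u ∈ S := by
      rw [hS]
      exact ⟨huF, fun v hv => le_trans huJ (hs' v hv)⟩
    rcases mem_iInter.mp hu u.1 with h | h
    · exact h huS
    · simp at h
      linarith
  obtain ⟨δ, hδ, hVδ⟩ := hK.exists_forall_le' hVc.continuousOn hKpos
  have hM := hw' s hsU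
  have hB : 0 < (J s - J w) / δ + 1 := by
    have := div_nonneg (sub_nonneg.mpr hM) hδ.le
    linarith
  refine ⟨fun _ => (J s - J w) / δ + 1, fun _ => hB, ?_⟩
  intro β hβ u huU hmin
  have h1 := hmin s hsU
  have h2 : ∑ i, β i * min (c i s) 0 = 0 :=
    Finset.sum_eq_zero fun i _ => by rw [min_eq_right (hsc i), mul_zero]
  have h3 : ((J s - J w) / δ + 1) * V u ≤ -∑ i, β i * min (c i u) 0 := by
    rw [Finset.mul_sum, ← Finset.sum_neg_distrib]
    refine Finset.sum_le_sum fun i _ => ?_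
    have := mul_le_mul_of_nonneg_right (hβ i).le (hterm u i)
    linarith
  have hV0 : 0 ≤ V u := Finset.sum_nonneg fun i _ => hterm u i
  have h4 := mul_nonneg hB.le hV0
  by_contra hcon
  push Not at hcon
  have huK : u ∈ K := by
    refine ⟨⟨huU, ?_⟩, mem_iInter.mpr fun x => ?_⟩
    · show J u ≤ J s
      linarith
    · by_cases hx : (x, u.2) ∈ S
      · exact Or.inr (hcon x hx)
      · exact Or.inl hx
  have h5 := mul_le_mul_of_nonneg_left (hVδ u huK) hB.le
  have h6 : ((J s - J w) / δ + 1) * δ = J s - J w + δ := by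
    field_simp
  have h7 := hw' u huU
  linarith
end

section
/- Let n, m, n_c ∈ ℕ and let U = ⋃_{i=1}^{N} X_i × {z_i} ⊆ ℝⁿ × ℤᵐ, where N is finite, each X_i ⊆ ℝⁿ is a nonempty compact set, and z_1, …, z_N ∈ ℤᵐ are pairwise distinct. Let J̄, L : ℝⁿ × ℤᵐ → ℝ and c_1, …, c_{n_c} : ℝⁿ × ℤᵐ → ℝ be continuous in the ℝⁿ-variable for each fixed ℤᵐ-variable. Assume the feasible set F = {u ∈ U : c_i(u) ≥ 0 ∀i} is nonempty; let S be the set of minimizers of J̄ over F and let L* = min_{u∈S} L(u). For β ∈ ℝ^{n_c} with β_i > 0 and λ > 0 define L̃(β, λ) = (1/λ)·[ min_{u∈U} ( λ·L(u) + J̄(u) − Σ_i β_i·min(c_i(u), 0) ) − min_{u∈U} ( J̄(u) − Σ_i β_i·min(c_i(u), 0) ) ]. Then for every ε > 0 there exists λ₀ > 0 such that for every λ ∈ (0, λ₀) there exists β₀ ∈ ℝ^{n_c} such that for all β with β_i > (β₀)_i for all i, one has |L̃(β, λ) − L*| < ε. -/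
open Set

theorem aux_exact {E : Type*} [TopologicalSpace E] {K : Set E} (hK : IsCompact K)
    {h P : E → ℝ} (hh : Continuous h) (hP : Continuous P) (hP0 : ∀ u ∈ K, 0 ≤ P u)
    (hpos : ∀ u ∈ K, P u = 0 → 0 < h u) :
    ∃ M : ℝ, 0 ≤ M ∧ ∀ u ∈ K, 0 ≤ h u + M * P u := by
  have hA : IsCompact (K ∩ {u | h u ≤ 0}) := hK.inter_right (isClosed_le hh continuous_const)
  rcases (K ∩ {u | h u ≤ 0}).eq_empty_or_nonempty with he | hne
  · refine ⟨0, le_rfl, fun u hu => ?_⟩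
    by_contra hcon
    have : u ∈ K ∩ {u | h u ≤ 0} := ⟨hu, by simp only [mem_setOf_eq]; linarith⟩
    rw [he] at this
    exact this
  · obtain ⟨a, ha, hamin⟩ := hA.exists_isMinOn hne hP.continuousOn
    obtain ⟨b, hb, hbmin⟩ := hA.exists_isMinOn hne hh.continuousOn
    have hap : 0 < P a := by
      rcases (hP0 a ha.1).lt_or_eq with h1 | h1
      · exact h1
      · have h2 := hpos a ha.1 h1.symm
        have h3 : h a ≤ 0 := ha.2
        linarith
    have hb0 : h b ≤ 0 := hb.2
    have hM : 0 ≤ -h b / P a := div_nonneg (by linarith) hap.le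
    refine ⟨-h b / P a, hM, fun u hu => ?_⟩
    by_cases hu0 : h u ≤ 0
    · have h1 : P a ≤ P u := hamin ⟨hu, hu0⟩
      have h2 : h b ≤ h u := hbmin ⟨hu, hu0⟩
      have h3 := mul_le_mul_of_nonneg_left h1 hM
      rw [div_mul_cancel₀ _ hap.ne'] at h3
      linarith
    · have := mul_nonneg hM (hP0 u hu)
      linarith

theorem aux_pen {E : Type*} [TopologicalSpace E] {K : Set E} (hK : IsCompact K) {k : ℕ}
    {G : E → ℝ} (hG : Continuous G) {c : Fin k → E → ℝ} (hc : ∀ i, Continuous (c i))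
    {g d : ℝ} (hd : 0 < d) (hg : ∀ u ∈ K, (∀ i, 0 ≤ c i u) → g ≤ G u) :
    ∃ M : ℝ, ∀ β : Fin k → ℝ, (∀ i, M < β i) →
      ∀ u ∈ K, g - d ≤ G u - ∑ i, β i * min (c i u) 0 := by
  have hn : ∀ i u, 0 ≤ -min (c i u) 0 := fun i u => by
    have := min_le_right (c i u) 0
    linarith
  obtain ⟨M, hM, h⟩ := aux_exact hK (h := fun u => G u - g + d)
    (P := fun u => ∑ i, -min (c i u) 0) (by fun_prop)
    (continuous_finset_sum _ fun i _ => ((hc i).min continuous_const).neg)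
    (fun u _ => Finset.sum_nonneg fun i _ => hn i u)
    (fun u hu h0 => by
      have h1 := (Finset.sum_eq_zero_iff_of_nonneg (fun i _ => hn i u)).1 h0
      have := hg u hu (fun i => by
        have h2 := h1 i (Finset.mem_univ i)
        have h3 := min_le_left (c i u) 0
        linarith)
      show 0 < G u - g + d
      linarith)
  refine ⟨M, fun β hβ u hu => ?_⟩
  have h1 := h u hu
  have h2 : M * ∑ i, -min (c i u) 0 ≤ - ∑ i, β i * min (c i u) 0 := by
    rw [Finset.mul_sum, ← Finset.sum_neg_distrib]
    refine Finset.sum_le_sum fun i _ => ?_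
    have := mul_le_mul_of_nonneg_right (hβ i).le (hn i u)
    linarith
  linarith

/-- For sufficiently small `λ` and sufficiently large penalties `β`, the approximate loss
`L̃(β, λ)` is within `ε` of `L* = min_{u ∈ S} L(u)`, the minimum of the loss over the set of
optimal solutions of the constrained problem. -/
theorem stmt12 {n m nc N : ℕ}
    (X : Fin N → Set (EuclideanSpace ℝ (Fin n))) (z : Fin N → (Fin m → ℤ))
    (hXne : ∀ i, (X i).Nonempty) (hXcpt : ∀ i, IsCompact (X i))
    (hz : Function.Injective z)
    (J L : EuclideanSpace ℝ (Fin n) × (Fin m → ℤ) → ℝ)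
    (c : Fin nc → EuclideanSpace ℝ (Fin n) × (Fin m → ℤ) → ℝ)
    (hJ : ∀ zz : Fin m → ℤ, Continuous fun x => J (x, zz))
    (hL : ∀ zz : Fin m → ℤ, Continuous fun x => L (x, zz))
    (hc : ∀ (i : Fin nc) (zz : Fin m → ℤ), Continuous fun x => c i (x, zz))
    (U : Set (EuclideanSpace ℝ (Fin n) × (Fin m → ℤ)))
    (hU : U = ⋃ i, (X i) ×ˢ ({z i} : Set (Fin m → ℤ)))
    (F : Set (EuclideanSpace ℝ (Fin n) × (Fin m → ℤ)))
    (hF : F = {u ∈ U | ∀ i, 0 ≤ c i u})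
    (hFne : F.Nonempty)
    (S : Set (EuclideanSpace ℝ (Fin n) × (Fin m → ℤ)))
    (hS : S = {u ∈ F | ∀ v ∈ F, J u ≤ J v})
    (Lstar : ℝ) (hLstar : Lstar = sInf (L '' S))
    {ε : ℝ} (hε : 0 < ε) :
    ∃ lam₀ : ℝ, 0 < lam₀ ∧ ∀ lam : ℝ, 0 < lam → lam < lam₀ →
      ∃ β₀ : Fin nc → ℝ, ∀ β : Fin nc → ℝ, (∀ i, β₀ i < β i) →
        |(1 / lam) *
            (sInf ((fun u => lam * L u + J u - ∑ i, β i * min (c i u) 0) '' U) -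
              sInf ((fun u => J u - ∑ i, β i * min (c i u) 0) '' U)) - Lstar| < ε := by
  have hJc : Continuous J := continuous_prod_of_discrete_right.2 hJ
  have hLc : Continuous L := continuous_prod_of_discrete_right.2 hL
  have hcc : ∀ i, Continuous (c i) := fun i => continuous_prod_of_discrete_right.2 (hc i)
  have hUc : IsCompact U := by
    rw [hU]
    exact isCompact_iUnion fun i => (hXcpt i).prod isCompact_singleton
  have hFc : IsCompact F := by
    have : F = U ∩ ⋂ i, {u | 0 ≤ c i u} := by
      rw [hF]; ext u; simp
    rw [this]
    exact hUc.inter_right (isClosed_iInter fun i => isClosed_le continuous_const (hcc i))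
  obtain ⟨a, haF, hamin⟩ := hFc.exists_isMinOn hFne hJc.continuousOn
  have hJa : ∀ v ∈ F, J a ≤ J v := fun v hv => hamin hv
  have hSeq : S = F ∩ {u | J u ≤ J a} := by
    rw [hS]; ext u
    constructor
    · rintro ⟨h1, h2⟩
      exact ⟨h1, h2 a haF⟩
    · rintro ⟨h1, h2⟩
      exact ⟨h1, fun v hv => le_trans h2 (hJa v hv)⟩
  have hSc : IsCompact S := by
    rw [hSeq]
    exact hFc.inter_right (isClosed_le hJc continuous_const)
  have hSne : S.Nonempty := ⟨a, by rw [hSeq]; exact ⟨haF, le_refl (J a)⟩⟩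
  obtain ⟨b, hbS, hbL⟩ := hSc.exists_sInf_image_eq hSne hLc.continuousOn
  rw [← hLstar] at hbL
  have hLmin : ∀ u ∈ S, Lstar ≤ L u := fun u hu => by
    rw [hLstar]
    exact csInf_le (hSc.image hLc).bddBelow ⟨u, hu, rfl⟩
  have hb2 := hbS
  rw [hSeq] at hb2
  obtain ⟨hbF, hbJ'⟩ := hb2
  have hbJ : J b = J a := le_antisymm hbJ' (hJa b hbF)
  have hb3 := hbF
  rw [hF] at hb3
  obtain ⟨hbU, hbc⟩ := hb3
  have hmemF : ∀ u ∈ U, (∀ i, 0 ≤ c i u) → u ∈ F := fun u h1 h2 => by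
    rw [hF]; exact ⟨h1, h2⟩
  have hbsum : ∀ β : Fin nc → ℝ, ∑ i, β i * min (c i b) 0 = 0 := fun β =>
    Finset.sum_eq_zero fun i _ => by rw [min_eq_right (hbc i), mul_zero]
  obtain ⟨M, hM, hMF⟩ := aux_exact hFc (h := fun u => L u - Lstar + ε / 2)
    (P := fun u => J u - J a) (by fun_prop) (by fun_prop)
    (fun u hu => sub_nonneg.2 (hJa u hu))
    (fun u hu h0 => by
      have h1 : u ∈ S := by
        rw [hSeq]
        exact ⟨hu, (sub_eq_zero.1 h0).le⟩
      have := hLmin u h1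
      show 0 < L u - Lstar + ε / 2
      linarith)
  refine ⟨1 / (M + 1), by positivity, fun lam hl hl' => ?_⟩
  have hlM : lam * M ≤ 1 := by
    rw [lt_div_iff₀ (by positivity)] at hl'
    linarith
  have hd : 0 < lam * (ε / 4) := by positivity
  obtain ⟨M1, h1⟩ := aux_pen hUc (G := fun u => lam * L u + J u) (by fun_prop) hcc
    (g := lam * (Lstar - ε / 2) + J a) hd (fun u hu huc => by
      have huF := hmemF u hu huc
      have e1 := mul_nonneg hl.le (hMF u huF)
      have e2 := mul_le_mul_of_nonneg_right hlM (sub_nonneg.2 (hJa u huF))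

      nlinarith)
  obtain ⟨M2, h2⟩ := aux_pen hUc (G := J) hJc hcc (g := J a) hd
    (fun u hu huc => hJa u (hmemF u hu huc))
  refine ⟨fun _ => max M1 M2, fun β hβ => ?_⟩
  have k1 := h1 β fun i => lt_of_le_of_lt (le_max_left _ _) (hβ i)
  have k2 := h2 β fun i => lt_of_le_of_lt (le_max_right _ _) (hβ i)
  have hUne : U.Nonempty := ⟨b, hbU⟩
  set A := sInf ((fun u => lam * L u + J u - ∑ i, β i * min (c i u) 0) '' U) with hA
  set B := sInf ((fun u => J u - ∑ i, β i * min (c i u) 0) '' U) with hB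
  have A1 : lam * (Lstar - ε / 2) + J a - lam * (ε / 4) ≤ A :=
    le_csInf (hUne.image _) (by rintro _ ⟨u, hu, rfl⟩; exact k1 u hu)
  have B1 : J a - lam * (ε / 4) ≤ B :=
    le_csInf (hUne.image _) (by rintro _ ⟨u, hu, rfl⟩; exact k2 u hu)
  have A2 : A ≤ lam * Lstar + J a :=
    csInf_le ⟨_, by rintro _ ⟨u, hu, rfl⟩; exact k1 u hu⟩
      ⟨b, hbU, by simp only [hbsum]; rw [hbL, hbJ, sub_zero]⟩
  have B2 : B ≤ J a :=
    csInf_le ⟨_, by rintro _ ⟨u, hu, rfl⟩; exact k2 u hu⟩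
      ⟨b, hbU, by simp only [hbsum]; rw [hbJ, sub_zero]⟩
  have e : 1 / lam * (A - B) - Lstar = (A - B - lam * Lstar) / lam := by
    field_simp
  have hle : 0 < lam * ε := by positivity
  rw [e, abs_lt]
  constructor
  · rw [lt_div_iff₀ hl]
    linarith
  · rw [div_lt_iff₀ hl]
    linarith
end

section
/- Let n, p ∈ ℕ, let U ⊆ ℝⁿ, let λ ≠ 0, let P, Q : ℝⁿ × ℝ^p → ℝ, let x_p, x_q : ℝ^p → ℝⁿ, and let o₀ ∈ ℝ^p. Assume: (i) P is Fréchet differentiable at (x_p(o₀), o₀) and Q is Fréchet differentiable at (x_q(o₀), o₀); (ii) x_p and x_q are differentiable at o₀; (iii) there is a neighborhood W of o₀ such that for every o ∈ W, x_p(o) ∈ U minimizes u ↦ P(u, o) over U and x_q(o) ∈ U minimizes u ↦ Q(u, o) over U; (iv) x_p(o₀) and x_q(o₀) lie in the interior of U. Then the function L̃(o) := (1/λ)·( P(x_p(o), o) − Q(x_q(o), o) ) is differentiable at o₀, and its derivative equals (1/λ)·( D_o P(x_p(o₀), o₀) − D_o Q(x_q(o₀), o₀) ), where D_o denotes the partial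 Fréchet derivative with respect to the second argument; i.e., the terms involving the derivatives of the minimizer selections x_p, x_q vanish. -/
theorem envelope_aux {E F : Type*} [NormedAddCommGroup E] [NormedSpace ℝ E]
    [NormedAddCommGroup F] [NormedSpace ℝ F] (U : Set E) (P : E × F → ℝ) (x : F → E) (o₀ : F)
    (hP : DifferentiableAt ℝ P (x o₀, o₀)) (hx : DifferentiableAt ℝ x o₀)
    (hmin : ∀ u ∈ U, P (x o₀, o₀) ≤ P (u, o₀)) (hint : x o₀ ∈ interior U) :
    HasFDerivAt (fun o => P (x o, o)) (fderiv ℝ (fun o => P (x o₀, o)) o₀) o₀ := by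
  have hP' := hP.hasFDerivAt
  have h1 : HasFDerivAt (fun u => P (u, o₀)) _ (x o₀) :=
    HasFDerivAt.comp (x o₀) hP' ((hasFDerivAt_id (x o₀)).prodMk (hasFDerivAt_const o₀ (x o₀)))
  have h2 : HasFDerivAt (fun o => P (x o₀, o)) _ o₀ :=
    HasFDerivAt.comp o₀ hP' ((hasFDerivAt_const (x o₀) o₀).prodMk (hasFDerivAt_id o₀))
  have h3 : HasFDerivAt (fun o => P (x o, o)) _ o₀ :=
    HasFDerivAt.comp o₀ hP' (hx.hasFDerivAt.prodMk (hasFDerivAt_id o₀))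
  have hloc : IsLocalMin (fun u => P (u, o₀)) (x o₀) := by
    filter_upwards [mem_interior_iff_mem_nhds.mp hint] with u hu using hmin u hu
  have h0 := hloc.hasFDerivAt_eq_zero h1
  rw [h2.fderiv]
  refine h3.congr_fderiv ?_
  ext v
  have h4 := DFunLike.congr_fun h0 (fderiv ℝ x o₀ v)
  have h5 : (fderiv ℝ x o₀ v, v) = (fderiv ℝ x o₀ v, (0 : F)) + ((0 : E), v) := by simp
  simp at h4
  simp
  rw [h5, map_add, h4, zero_add]

/-- Derivative of the approximate loss: if `x_p о` and `x_q o` minimize `P (·, o)` and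
`Q (·, o)` over `U` for `o` near `o₀`, the minimizers are differentiable and interior, and
`P`, `Q` are Fréchet differentiable, then `o ↦ (1/λ)(P (x_p o, o) − Q (x_q o, o))` is
differentiable at `o₀` with derivative `(1/λ)(D_o P − D_o Q)`: the terms involving the
derivatives of the minimizer selections vanish. -/
theorem stmt13 {n p : ℕ} (U : Set (EuclideanSpace ℝ (Fin n))) {lam : ℝ} (hlam : lam ≠ 0)
    (P Q : EuclideanSpace ℝ (Fin n) × EuclideanSpace ℝ (Fin p) → ℝ)
    (xp xq : EuclideanSpace ℝ (Fin p) → EuclideanSpace ℝ (Fin n))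
    (o₀ : EuclideanSpace ℝ (Fin p))
    (hP : DifferentiableAt ℝ P (xp o₀, o₀)) (hQ : DifferentiableAt ℝ Q (xq o₀, o₀))
    (hxp : DifferentiableAt ℝ xp o₀) (hxq : DifferentiableAt ℝ xq o₀)
    (W : Set (EuclideanSpace ℝ (Fin p))) (hW : W ∈ nhds o₀)
    (hminp : ∀ o ∈ W, xp o ∈ U ∧ ∀ u ∈ U, P (xp o, o) ≤ P (u, o))
    (hminq : ∀ o ∈ W, xq o ∈ U ∧ ∀ u ∈ U, Q (xq o, o) ≤ Q (u, o))
    (hintp : xp o₀ ∈ interior U) (hintq : xq o₀ ∈ interior U) :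
    HasFDerivAt (fun o => (1 / lam) * (P (xp o, o) - Q (xq o, o)))
      ((1 / lam) •
        (fderiv ℝ (fun o => P (xp o₀, o)) o₀ - fderiv ℝ (fun o => Q (xq o₀, o)) o₀)) o₀ := by
  have h1 := envelope_aux U P xp o₀ hP hxp (hminp o₀ (mem_of_mem_nhds hW)).2 hintp
  have h2 := envelope_aux U Q xq o₀ hQ hxq (hminq o₀ (mem_of_mem_nhds hW)).2 hintq
  exact (h1.sub h2).const_mul (1 / lam)
end

section
/- Let Ω be a metric space with Borel probability measure P, let S ⊆ Ω be a Borel set, let ζ > 0, and let t_1, …, t_n ∈ Ω form a ζ-coverage of Ω. Define the classified-safe region C = ⋃_{i : t_i ∈ S} B(t_i, ζ). Then: (a) P(C \ S) ≤ P((⋃_{ω∈S} B(ω, ζ)) \ S), and (b) P(S \ C) ≤ P(S ∩ ⋃_{ω∈Ω\S} B(ω, ζ)). That is, the Type I error mass (points misclassified as safe) is bounded by the measure of the ζ-inflation of S outside S, and the Type II error mass (safe points misclassified as unsafe) is bounded by the measure of the part of S within distance ζ of the unsafe set. -/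
open MeasureTheory Metric Set

/-- Error bounds for the coverage-based safety classifier: if `t 1, …, t n` form a
`ζ`-coverage of `Ω` and `C` is the union of `ζ`-balls around the test points lying in the safe
set `S`, then the Type I error mass `P (C \ S)` is bounded by the measure of the `ζ`-inflation
of `S` outside `S`, and the Type II error mass `P (S \ C)` is bounded by the measure of the
part of `S` within distance `ζ` of the unsafe set. -/
theorem stmt16 {Ω : Type*} [MetricSpace Ω] [MeasurableSpace Ω] [BorelSpace Ω]
    (P : Measure Ω) [IsProbabilityMeasure P]
    (S : Set Ω) (hS : MeasurableSet S) {ζ : ℝ} (hζ : 0 < ζ)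
    {n : ℕ} (t : Fin n → Ω) (hcov : (⋃ i, ball (t i) ζ) = Set.univ) :
    P ((⋃ i ∈ {i : Fin n | t i ∈ S}, ball (t i) ζ) \ S)
        ≤ P ((⋃ x ∈ S, ball x ζ) \ S) ∧
    P (S \ (⋃ i ∈ {i : Fin n | t i ∈ S}, ball (t i) ζ))
        ≤ P (S ∩ ⋃ x ∈ (Sᶜ : Set Ω), ball x ζ) := by
  constructor
  · apply measure_mono
    rintro y ⟨hy, hyS⟩
    obtain ⟨i, hi, hb⟩ := mem_iUnion₂.1 hy
    exact ⟨mem_iUnion₂.2 ⟨t i, hi, hb⟩, hyS⟩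
  · apply measure_mono
    rintro y ⟨hyS, hy⟩
    have h : y ∈ ⋃ i, ball (t i) ζ := hcov ▸ mem_univ y
    obtain ⟨i, hb⟩ := mem_iUnion.1 h
    exact ⟨hyS, mem_iUnion₂.2 ⟨t i, fun hi => hy (mem_iUnion₂.2 ⟨i, hi, hb⟩), hb⟩⟩
end

section
/- Let Ω be a metric space with Borel probability measure P and let S ⊆ Ω be a Borel set with 0 < P(S) < 1. Suppose there are constants k_s, k_us > 0 and radii r_s, r_us > 0 such that P((⋃_{ω∈S} B(ω, r)) \ S) ≤ k_s·r for all r with 0 < r ≤ r_s, and P((⋃_{ω∈Ω\S} B(ω, r)) \ (Ω\S)) ≤ k_us·r for all r with 0 < r ≤ r_us. Let p > 0 and let ζ > 0 satisfy ζ ≤ r_s, ζ ≤ r_us, ζ ≤ p·P(S)/k_us, and ζ ≤ p·P(Ω\S)/k_s. Let t_1, …, t_n ∈ Ω form a ζ-coverage of Ω and define the classified-safe region C = ⋃_{i : t_i ∈ S} B(t_i, ζ). Then the Type I error probability P(C \ S)/P(Ω\S) is at most p, and the Type II error probability P(S \ C)/P(S) is at most p. -/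
open MeasureTheory Metric Set

/-- If the safe set `S` and its complement have boundary-measure rate at most `k_s`, `k_us`
(up to radii `r_s`, `r_us`), and `ζ` is small enough relative to the target error level `p`,
then the coverage-based classifier built from a `ζ`-coverage `t 1, …, t n` has Type I and
Type II error probabilities at most `p`. -/
theorem stmt19 {Ω : Type*} [MetricSpace Ω] [MeasurableSpace Ω] [BorelSpace Ω]
    (P : Measure Ω) [IsProbabilityMeasure P]
    (S : Set Ω) (hS : MeasurableSet S)
    (hS0 : 0 < (P S).toReal) (hS1 : (P S).toReal < 1)
    {ks kus rs rus : ℝ} (hks : 0 < ks) (hkus : 0 < kus) (hrs : 0 < rs) (hrus : 0 < rus)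
    (hSbd : ∀ r : ℝ, 0 < r → r ≤ rs →
      (P ((⋃ x ∈ S, ball x r) \ S)).toReal ≤ ks * r)
    (hScbd : ∀ r : ℝ, 0 < r → r ≤ rus →
      (P ((⋃ x ∈ (Sᶜ : Set Ω), ball x r) \ Sᶜ)).toReal ≤ kus * r)
    {p : ℝ} (hp : 0 < p) {ζ : ℝ} (hζ : 0 < ζ)
    (hζrs : ζ ≤ rs) (hζrus : ζ ≤ rus)
    (hζ3 : ζ ≤ p * (P S).toReal / kus) (hζ4 : ζ ≤ p * (P (Sᶜ)).toReal / ks)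
    {n : ℕ} (t : Fin n → Ω) (hcov : (⋃ i, ball (t i) ζ) = Set.univ) :
    (P ((⋃ i ∈ {i : Fin n | t i ∈ S}, ball (t i) ζ) \ S)).toReal / (P (Sᶜ)).toReal ≤ p ∧
    (P (S \ (⋃ i ∈ {i : Fin n | t i ∈ S}, ball (t i) ζ))).toReal / (P S).toReal ≤ p := by
  rw [le_div_iff₀ hkus] at hζ3
  rw [le_div_iff₀ hks] at hζ4
  constructor
  · refine div_le_of_le_mul₀ ENNReal.toReal_nonneg hp.le ?_
    have h1 := hSbd ζ hζ hζrs
    have h2 : (P ((⋃ i ∈ {i : Fin n | t i ∈ S}, ball (t i) ζ) \ S)).toReal ≤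
        (P ((⋃ x ∈ S, ball x ζ) \ S)).toReal := by
      refine ENNReal.toReal_mono (measure_ne_top _ _) (measure_mono ?_)
      rintro x ⟨hx, hxS⟩
      refine ⟨?_, hxS⟩
      simp only [mem_iUnion, mem_setOf_eq, exists_prop] at hx ⊢
      obtain ⟨i, hi, hxi⟩ := hx
      exact ⟨t i, hi, hxi⟩
    linarith
  · refine div_le_of_le_mul₀ ENNReal.toReal_nonneg hp.le ?_
    have h1 := hScbd ζ hζ hζrus
    have h2 : (P (S \ (⋃ i ∈ {i : Fin n | t i ∈ S}, ball (t i) ζ))).toReal ≤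
        (P ((⋃ x ∈ (Sᶜ : Set Ω), ball x ζ) \ Sᶜ)).toReal := by
      refine ENNReal.toReal_mono (measure_ne_top _ _) (measure_mono ?_)
      rintro x ⟨hxS, hx⟩
      refine ⟨?_, fun h => h hxS⟩
      have hc : x ∈ ⋃ i, ball (t i) ζ := hcov ▸ mem_univ x
      simp only [mem_iUnion, mem_setOf_eq, exists_prop] at hx hc ⊢
      obtain ⟨i, hi⟩ := hc
      exact ⟨t i, fun h => hx ⟨i, h, hi⟩, hi⟩
    linarith
end
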